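/- Fix an integer z ≥ 2. The function g : ℕ → ℝ defined by g(x) = P_I(x+z-1) · (1 - P_I(x+z)) is strictly decreasing, i.e., for all x ∈ ℕ and all integers Δ ≥ 1, g(x) > g(x+Δ). -/

import Mathlib

/-- If consecutive denominators `a`, `b` differ by at least one, then
`(1 / b) (1 - 1 / c) < (1 / a) (1 - 1 / b)` for every positive `c`. -/
theorem mul_one_sub_one_div_lt {a b c : ℝ} (ha : 0 < a) (hb : 0 < b) (hc : 0 < c)
    (hab : a + 1 ≤ b) : 1 / b * (1 - 1 / c) < 1 / a * (1 - 1 / b) := by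
  have hdiff : 1 / a * (1 - 1 / b) - 1 / b * (1 - 1 / c) =
      (c * (b - a - 1) + a) / (a * b * c) := by
    field_simp
    ring
  have hnum : 0 < c * (b - a - 1) + a :=
    add_pos_of_nonneg_of_pos (mul_nonneg hc.le (by linarith)) ha
  have : 0 < (c * (b - a - 1) + a) / (a * b * c) := by positivity
  linarith

/-- With P_I(x) = 1/(x^u + C_I), C_I > 0, u ≥ 1, and z ≥ 2 fixed, the function
g(x) = P_I(x+z-1) · (1 - P_I(x+z)) is strictly decreasing: for all x and all Δ ≥ 1,
g(x) > g(x+Δ). -/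
theorem stmt_1 (C_I : ℝ) (hC : 0 < C_I) (u : ℕ) (hu : 1 ≤ u)
    (P_I : ℕ → ℝ) (hP : ∀ x : ℕ, P_I x = 1 / ((x : ℝ) ^ u + C_I))
    (z : ℕ) (hz : 2 ≤ z)
    (g : ℕ → ℝ) (hg : ∀ x : ℕ, g x = P_I (x + z - 1) * (1 - P_I (x + z))) :
    ∀ (x Δ : ℕ), 1 ≤ Δ → g (x + Δ) < g x := by
  have step : ∀ n : ℕ, g (n + 1) < g n := by
    intro n
    obtain ⟨k, rfl⟩ : ∃ k, z = k + 1 := ⟨z - 1, by omega⟩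
    have h₁ : n + 1 + (k + 1) - 1 = n + k + 1 := by omega
    have h₂ : n + (k + 1) - 1 = n + k := by omega
    have h₃ : n + 1 + (k + 1) = n + k + 2 := by omega
    have h₄ : n + (k + 1) = n + k + 1 := by omega
    rw [hg, hg, h₁, h₂, h₃, h₄, hP, hP, hP]
    have hgap : ((n + k : ℕ) : ℝ) ^ u + 1 ≤ ((n + k + 1 : ℕ) : ℝ) ^ u := by
      exact_mod_cast Nat.pow_lt_pow_left (Nat.lt_succ_self (n + k)) (by omega)
    have hpos : ∀ m : ℕ, 0 < (m : ℝ) ^ u + C_I := fun m => by positivity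
    exact mul_one_sub_one_div_lt (hpos _) (hpos _) (hpos _) (by linarith)
  intro x Δ hΔ
  exact strictAnti_nat_of_succ_lt step (by omega)
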